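/- The inverse quadratic matrix A_{ij} = 1/(c² + ‖x_i − x_j‖²) on pairwise distinct points x_1,…,x_N ∈ ℝ^d with c > 0 is positive definite. -/

import Mathlib

open MeasureTheory ProbabilityTheory Filter Topology in
lemma gauss_re (d : ℕ) (v : EuclideanSpace ℝ (Fin d)) :
    ∫ y, Real.cos (inner ℝ y v) ∂(stdGaussian (EuclideanSpace ℝ (Fin d))) =
      Real.exp (-‖v‖ ^ 2 / 2) := by
  have h := charFun_stdGaussian (E := EuclideanSpace ℝ (Fin d)) v
  rw [charFun_apply] at h
  have hi : Integrable (fun y => Complex.exp ((inner ℝ y v : ℝ) * Complex.I))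
      (stdGaussian (EuclideanSpace ℝ (Fin d))) := by
    refine Integrable.of_bound (C := 1) (Continuous.aestronglyMeasurable (by fun_prop)) ?_
    exact Eventually.of_forall fun y => by rw [Complex.norm_exp_ofReal_mul_I]
  have h2 := integral_re hi
  rw [h] at h2
  simp only [RCLike.re_eq_complex_re, Complex.exp_ofReal_mul_I_re] at h2
  rw [h2, ← Complex.exp_ofReal_re]
  push_cast
  rfl

open MeasureTheory ProbabilityTheory Filter Topology in
lemma gauss_nonneg (d N : ℕ) (x : Fin N → EuclideanSpace ℝ (Fin d)) (lam : Fin N → ℝ)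
    (t : ℝ) (ht : 0 ≤ t) :
    0 ≤ ∑ i, ∑ j, lam i * lam j * Real.exp (-(t * ‖x i - x j‖ ^ 2)) := by
  have key : ∑ i, ∑ j, lam i * lam j * Real.exp (-(t * ‖x i - x j‖ ^ 2)) =
      ∫ y, ((∑ i, lam i * Real.cos (inner ℝ y (√(2 * t) • x i))) ^ 2 +
        (∑ i, lam i * Real.sin (inner ℝ y (√(2 * t) • x i))) ^ 2)
        ∂(stdGaussian (EuclideanSpace ℝ (Fin d))) := by
    have hE : ∀ y : EuclideanSpace ℝ (Fin d),
        ((∑ i, lam i * Real.cos (inner ℝ y (√(2 * t) • x i))) ^ 2 +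
        (∑ i, lam i * Real.sin (inner ℝ y (√(2 * t) • x i))) ^ 2) =
        ∑ i, ∑ j, lam i * lam j * Real.cos (inner ℝ y (√(2 * t) • (x i - x j))) := by
      intro y
      rw [sq, sq, Finset.sum_mul_sum, Finset.sum_mul_sum, ← Finset.sum_add_distrib]
      refine Finset.sum_congr rfl fun i _ => ?_
      rw [← Finset.sum_add_distrib]
      refine Finset.sum_congr rfl fun j _ => ?_
      rw [smul_sub, inner_sub_right, Real.cos_sub]
      ring
    have hi : ∀ i j, Integrable (fun y => lam i * lam j *
        Real.cos (inner ℝ y (√(2 * t) • (x i - x j))))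
        (stdGaussian (EuclideanSpace ℝ (Fin d))) := by
      intro i j
      refine Integrable.const_mul ?_ _
      refine Integrable.of_bound (C := 1) (Continuous.aestronglyMeasurable (by fun_prop)) ?_
      exact Eventually.of_forall fun y => Real.abs_cos_le_one _
    simp_rw [hE]
    rw [integral_finsetSum _ fun i _ => integrable_finsetSum _ fun j _ => hi i j]
    refine Finset.sum_congr rfl fun i _ => ?_
    rw [integral_finsetSum _ fun j _ => hi i j]
    refine Finset.sum_congr rfl fun j _ => ?_
    rw [integral_const_mul, gauss_re, norm_smul, mul_pow, Real.norm_eq_abs, sq_abs,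
      Real.sq_sqrt (by positivity)]
    ring_nf
  rw [key]
  exact integral_nonneg fun y => by positivity

open MeasureTheory ProbabilityTheory Filter Topology in
lemma gauss_tendsto (d N : ℕ) (x : Fin N → EuclideanSpace ℝ (Fin d))
    (hx : Function.Injective x) (lam : Fin N → ℝ) :
    Tendsto (fun t : ℝ => ∑ i, ∑ j, lam i * lam j * Real.exp (-(t * ‖x i - x j‖ ^ 2))) atTop
      (𝓝 (∑ i, lam i ^ 2)) := by
  have : ∑ i, lam i ^ 2 = ∑ i, ∑ j, lam i * lam j * (if i = j then 1 else 0) := by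
    simp [sq]
  rw [this]
  refine tendsto_finsetSum _ fun i _ => tendsto_finsetSum _ fun j _ => Tendsto.const_mul _ ?_
  split_ifs with h
  · subst h; simp
  · have : 0 < ‖x i - x j‖ ^ 2 := by
      have := norm_pos_iff.2 (sub_ne_zero.2 (hx.ne h))
      positivity
    exact Real.tendsto_exp_neg_atTop_nhds_zero.comp (tendsto_id.atTop_mul_const this)

open MeasureTheory ProbabilityTheory Filter Topology in
theorem inverse_quadratic_pos_def (d N : ℕ) (c : ℝ) (hc : 0 < c)
    (x : Fin N → EuclideanSpace ℝ (Fin d)) (hx : Function.Injective x)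
    (lam : Fin N → ℝ) (hlam : lam ≠ 0) :
    0 < ∑ i, ∑ j, lam i * lam j * (c ^ 2 + ‖x i - x j‖ ^ 2)⁻¹ := by
  have hpos : 0 < ∑ i, lam i ^ 2 := by
    obtain ⟨i, hi⟩ := Function.ne_iff.1 hlam
    refine Finset.sum_pos' (fun i _ => sq_nonneg _) ⟨i, Finset.mem_univ _, ?_⟩
    exact sq_pos_of_ne_zero hi
  have hneg : ∀ i j, -(c ^ 2 + ‖x i - x j‖ ^ 2) < 0 := fun i j => by
    rw [neg_lt_zero]; positivity
  have hint : ∀ i j, IntegrableOn (fun t : ℝ => lam i * lam j *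
      Real.exp (-(c ^ 2 + ‖x i - x j‖ ^ 2) * t)) (Set.Ioi 0) := fun i j =>
    (integrableOn_exp_mul_Ioi (hneg i j) 0).const_mul _
  have hf : ∀ t : ℝ, ∑ i, ∑ j, lam i * lam j * Real.exp (-(c ^ 2 + ‖x i - x j‖ ^ 2) * t) =
      Real.exp (-(c ^ 2 * t)) *
        ∑ i, ∑ j, lam i * lam j * Real.exp (-(t * ‖x i - x j‖ ^ 2)) := by
    intro t
    simp_rw [Finset.mul_sum]
    refine Finset.sum_congr rfl fun i _ => Finset.sum_congr rfl fun j _ => ?_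
    rw [mul_left_comm, ← Real.exp_add]
    ring_nf
  have key : ∑ i, ∑ j, lam i * lam j * (c ^ 2 + ‖x i - x j‖ ^ 2)⁻¹ =
      ∫ t in Set.Ioi (0 : ℝ), ∑ i, ∑ j, lam i * lam j *
        Real.exp (-(c ^ 2 + ‖x i - x j‖ ^ 2) * t) := by
    rw [integral_finsetSum _ fun i _ => integrable_finsetSum _ fun j _ => hint i j]
    refine Finset.sum_congr rfl fun i _ => ?_
    rw [integral_finsetSum _ fun j _ => hint i j]
    refine Finset.sum_congr rfl fun j _ => ?_
    rw [integral_const_mul, integral_exp_mul_Ioi (hneg i j)]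
    simp only [mul_zero, Real.exp_zero, neg_div_neg_eq, one_div]
  rw [key, setIntegral_pos_iff_support_of_nonneg_ae]
  · obtain ⟨T, hT⟩ := eventually_atTop.1
      ((gauss_tendsto d N x hx lam).eventually (lt_mem_nhds hpos))
    refine lt_of_lt_of_le ?_ (measure_mono (s := Set.Ioi (max T 0)) ?_)
    · simp
    · intro t ht
      rw [Set.mem_Ioi, max_lt_iff] at ht
      refine ⟨?_, ht.2⟩
      rw [Function.mem_support, hf]
      exact (mul_pos (Real.exp_pos _) (hT t ht.1.le)).ne'
  · refine (ae_restrict_iff' measurableSet_Ioi).2 (Eventually.of_forall fun t ht => ?_)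
    refine le_of_le_of_eq ?_ (hf t).symm
    exact mul_nonneg (Real.exp_pos _).le (gauss_nonneg d N x lam t (le_of_lt ht))
  · exact integrable_finsetSum _ fun i _ => integrable_finsetSum _ fun j _ => hint i j
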